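/- Let n ≥ 1. The images in R̄_n of the words q_{j_1}⋯q_{j_k}, as (j_1, …, j_k) ranges over all completely unadmissible sequences of natural numbers of all lengths k ≥ 0 with j_k ≥ n (the empty sequence contributing the unit 1), form a basis of R̄_n as a ZMod 2-vector space. -/

import Mathlib

/-- The word `q_{j_1} ⋯ q_{j_k}` in the free associative unital `ZMod 2`-algebra on
generators `q_j` indexed by natural numbers `j`. -/
noncomputable def word (J : List ℕ) : FreeAlgebra (ZMod 2) ℕ :=
  (J.map (FreeAlgebra.ι (ZMod 2))).prod

/-- The relations defining `R̄_n`: (1) the excess relations, killing every word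
`q_{j_1}⋯q_{j_k}` (`k ≥ 1`) with `j_1 < j_2 + ⋯ + j_k + n`; and (2) the relations
`q_r·q_s = ∑_{ℓ=0}^{r-s-1} ((2s-r+1+2ℓ) choose ℓ mod 2)·q_{2s+1+ℓ}·q_{r-s-1-ℓ}`
for `s < r ≤ 2s` (equivalently, in characteristic 2, the two-sided ideal generated
by the sums `q_r·q_s + ∑_ℓ ⋯`). -/
inductive BarRel (n : ℕ) : FreeAlgebra (ZMod 2) ℕ → FreeAlgebra (ZMod 2) ℕ → Prop
  | excess (j : ℕ) (J : List ℕ) (h : j < J.sum + n) : BarRel n (word (j :: J)) 0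
  | adem (r s : ℕ) (h1 : s < r) (h2 : r ≤ 2 * s) :
      BarRel n (FreeAlgebra.ι (ZMod 2) r * FreeAlgebra.ι (ZMod 2) s)
        (∑ ℓ ∈ Finset.range (r - s),
          ((2 * s - r + 1 + 2 * ℓ).choose ℓ : ZMod 2) •
            (FreeAlgebra.ι (ZMod 2) (2 * s + 1 + ℓ) * FreeAlgebra.ι (ZMod 2) (r - s - 1 - ℓ)))

/-- The algebra `R̄_n`: the quotient of the free associative unital `ZMod 2`-algebra on
the generators `q_j` by the two-sided ideal generated by the relations `BarRel n`. -/
noncomputable def BarR (n : ℕ) := RingQuot (BarRel n)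

noncomputable instance (n : ℕ) : Ring (BarR n) :=
  inferInstanceAs (Ring (RingQuot (BarRel n)))

noncomputable instance (n : ℕ) : Algebra (ZMod 2) (BarR n) :=
  inferInstanceAs (Algebra (ZMod 2) (RingQuot (BarRel n)))

/-- The quotient map `FreeAlgebra (ZMod 2) ℕ → R̄_n`. -/
noncomputable def barMk (n : ℕ) : FreeAlgebra (ZMod 2) ℕ →ₐ[ZMod 2] BarR n :=
  RingQuot.mkAlgHom (ZMod 2) (BarRel n)

/-- The index set for the CU basis of `R̄_n`: completely unadmissible sequences
(of all lengths, the empty sequence included) whose last entry (excess) is at least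
`n`. -/
def CUSeq (n : ℕ) : Type :=
  {J : List ℕ // List.Chain' (fun a b => 2 * b + 1 ≤ a) J ∧ ∀ m ∈ J.getLast?, n ≤ m}

/-- Binomial coefficients modulo 2, extended to all integers so that Pascal's rule always holds. -/
def chooseZ (N m : ℤ) : ZMod 2 :=
  if m < 0 then 0 else if 0 ≤ N then (N.toNat.choose m.toNat : ZMod 2)
  else ((m - N - 1).toNat.choose m.toNat : ZMod 2)

lemma chooseZ_of_neg {N m : ℤ} (h : m < 0) : chooseZ N m = 0 := by
  simp [chooseZ, h]

lemma chooseZ_natCast (N m : ℕ) : chooseZ N m = (N.choose m : ZMod 2) := by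
  simp [chooseZ]

lemma chooseZ_of_lt {N m : ℤ} (hN : 0 ≤ N) (h : N < m) : chooseZ N m = 0 := by
  have hm : ¬ m < 0 := by omega
  rw [chooseZ, if_neg hm, if_pos hN, Nat.choose_eq_zero_of_lt (by omega), Nat.cast_zero]

lemma chooseZ_pascal (N m : ℤ) :
    chooseZ (N + 1) (m + 1) = chooseZ N (m + 1) + chooseZ N m := by
  have two : (2 : ZMod 2) = 0 := rfl
  rcases lt_trichotomy m (-1) with hm | rfl | hm
  · simp [chooseZ, show m + 1 < 0 by omega, show m < 0 by omega]
  · simp [chooseZ]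
  · obtain ⟨k, rfl⟩ : ∃ k : ℕ, m = k := ⟨m.toNat, by omega⟩
    rcases lt_trichotomy N (-1) with hN | rfl | hN
    · obtain ⟨t, rfl⟩ : ∃ t : ℕ, N = -(t : ℤ) - 2 := ⟨(-N - 2).toNat, by omega⟩
      have e1 : ((k : ℤ) + 1 - (-(t : ℤ) - 2 + 1) - 1).toNat = k + t + 1 := by omega
      have e2 : ((k : ℤ) + 1 - (-(t : ℤ) - 2) - 1).toNat = k + t + 1 + 1 := by omega
      have e3 : ((k : ℤ) - (-(t : ℤ) - 2) - 1).toNat = k + t + 1 := by omega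
      have e4 : ((k : ℤ) + 1).toNat = k + 1 := by omega
      simp only [chooseZ, e1, e2, e3, e4, Int.toNat_natCast]
      have c1 : ¬ (k : ℤ) + 1 < 0 := by omega
      have c2 : ¬ (k : ℤ) < 0 := by omega
      have c3 : ¬ (0 : ℤ) ≤ -(t : ℤ) - 2 + 1 := by omega
      have c4 : ¬ (0 : ℤ) ≤ -(t : ℤ) - 2 := by omega
      rw [if_neg c1, if_neg c1, if_neg c2, if_neg c3, if_neg c4, if_neg c4,
        Nat.choose_succ_succ (k + t + 1) k]
      push_cast
      linear_combination (-((k + t + 1).choose k : ZMod 2)) * two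
    · have e4 : ((k : ℤ) + 1).toNat = k + 1 := by omega
      simp only [chooseZ, e4]
      have c1 : ¬ (k : ℤ) + 1 < 0 := by omega
      have c2 : ¬ (k : ℤ) < 0 := by omega
      simp [c1, c2, e4]
      linear_combination -two
    · obtain ⟨t, rfl⟩ : ∃ t : ℕ, N = t := ⟨N.toNat, by omega⟩
      have := Nat.choose_succ_succ t k
      rw [show (t : ℤ) + 1 = ((t + 1 : ℕ) : ℤ) by simp,
        show (k : ℤ) + 1 = ((k + 1 : ℕ) : ℤ) by simp, chooseZ_natCast, chooseZ_natCast,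
        chooseZ_natCast, this]
      push_cast
      ring

/-- The coefficient of `q_a q_(r+s-a)` in the Adem relation for `q_r q_s`. -/
def ademCoeff (r s a : ℤ) : ZMod 2 := chooseZ (r - a - 1) (a - 2 * s - 1)

lemma ademCoeff_natCast {r s ℓ : ℕ} (h : r ≤ 2 * s) :
    ademCoeff r s (2 * s + 1 + ℓ : ℕ) = ((2 * s - r + 1 + 2 * ℓ).choose ℓ : ZMod 2) := by
  have e1 : ¬ (0 : ℤ) ≤ r - (2 * s + 1 + ℓ : ℕ) - 1 := by push_cast; omega
  have e2 : ((2 * s + 1 + ℓ : ℕ) : ℤ) - 2 * s - 1 = ℓ := by push_cast; ring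
  rw [ademCoeff, chooseZ, e2, if_neg (by omega), if_neg e1]
  congr 2
  omega

lemma ademCoeff_eq_zero {r s a : ℤ} (hab : r + s - a < a) (hb : 0 ≤ r + s - a)
    (h : ¬ (0 ≤ s ∧ s < r)) : ademCoeff r s a = 0 := by
  rw [not_and_or, not_le, not_lt] at h
  by_cases hs : s < 0
  · exact chooseZ_of_lt (by omega) (by omega)
  · exact chooseZ_of_neg (by omega)

/-- Functions on pairs that are supported on `0 ≤ b < a` and are compatible with all
Adem relations. -/
structure AdemDual (ψ : ℤ → ℤ → ZMod 2) : Prop where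
  supp : ∀ a b, ψ a b ≠ 0 → 0 ≤ b ∧ b < a
  eq : ∀ r s, ψ r s = ∑ᶠ b, ademCoeff r s (r + s - b) * ψ (r + s - b) b

lemma finite_support_adem {ψ : ℤ → ℤ → ZMod 2} (h : ∀ a b, ψ a b ≠ 0 → 0 ≤ b ∧ b < a)
    (f : ℤ → ZMod 2) (d : ℤ) : (Function.support fun b => f b * ψ (d - b) b).Finite := by
  refine (Set.finite_Icc 0 d).subset fun b hb => ?_
  have := h _ _ (right_ne_zero_of_mul hb)
  simp only [Set.mem_Icc]
  omega

lemma AdemDual.zero : AdemDual fun _ _ => 0 := ⟨by simp, by simp⟩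

lemma AdemDual.add {ψ χ : ℤ → ℤ → ZMod 2} (hψ : AdemDual ψ) (hχ : AdemDual χ) :
    AdemDual fun a b => ψ a b + χ a b where
  supp a b h := by
    by_cases h1 : ψ a b = 0
    · exact hχ.supp a b (by simpa [h1] using h)
    · exact hψ.supp a b h1
  eq r s := by
    simp only [mul_add]
    rw [finsum_add_distrib (finite_support_adem hψ.supp _ _) (finite_support_adem hχ.supp _ _),
      ← hψ.eq, ← hχ.eq]

lemma AdemDual.shift {ψ : ℤ → ℤ → ZMod 2} (hψ : AdemDual ψ) :
    AdemDual fun a b => ψ (a - 2) (b - 1) where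
  supp a b h := by
    have := hψ.supp _ _ h
    omega
  eq r s := by
    rw [hψ.eq, ← finsum_comp_equiv (Equiv.subRight (1 : ℤ))]
    refine finsum_congr fun b => ?_
    simp only [Equiv.subRight_apply]
    congr 1
    · simp only [ademCoeff]
      congr 1 <;> ring
    · congr 1; ring

lemma AdemDual.skew {ψ : ℤ → ℤ → ZMod 2} (hψ : AdemDual ψ) :
    AdemDual fun a b => ψ (a - 2) b + ψ (a - 1) (b - 1) where
  supp a b h := by
    by_cases h1 : ψ (a - 2) b = 0
    · have := hψ.supp _ _ (show ψ (a - 1) (b - 1) ≠ 0 by simpa [h1] using h)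
      omega
    · have := hψ.supp _ _ h1
      omega
  eq r s := by
    have e1 : ∑ᶠ b, ademCoeff r s (r + s - b) * ψ (r + s - b - 2) b
        = ∑ᶠ b, ademCoeff r s (r + s - b) * ψ (r + s - 2 - b) b :=
      finsum_congr fun b => by congr 2; ring
    have e2 : ∑ᶠ b, ademCoeff r s (r + s - b) * ψ (r + s - b - 1) (b - 1)
        = ∑ᶠ b, ademCoeff r s (r + s - b - 1) * ψ (r + s - 2 - b) b := by
      rw [← finsum_comp_equiv (Equiv.addRight (1 : ℤ))]
      refine finsum_congr fun b => ?_
      simp only [Equiv.coe_addRight]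
      congr 2 <;> ring
    have e3 : ψ (r - 2) s = ∑ᶠ b, ademCoeff (r - 2) s (r + s - 2 - b) * ψ (r + s - 2 - b) b := by
      rw [hψ.eq]
      refine finsum_congr fun b => ?_
      rw [show r - 2 + s - b = r + s - 2 - b by ring]
    have e4 : ψ (r - 1) (s - 1) =
        ∑ᶠ b, ademCoeff (r - 1) (s - 1) (r + s - 2 - b) * ψ (r + s - 2 - b) b := by
      rw [hψ.eq]
      refine finsum_congr fun b => ?_
      rw [show r - 1 + (s - 1) - b = r + s - 2 - b by ring]
    have fin := finite_support_adem hψ.supp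
    have f1 : (Function.support fun b => ademCoeff r s (r + s - b) * ψ (r + s - b - 2) b).Finite := by
      convert fin (fun b => ademCoeff r s (r + s - b)) (r + s - 2) using 5
      ring
    have f2 : (Function.support
        fun b => ademCoeff r s (r + s - b) * ψ (r + s - b - 1) (b - 1)).Finite := by
      refine (Set.finite_Icc 0 (r + s)).subset fun b hb => ?_
      have := hψ.supp _ _ (right_ne_zero_of_mul hb)
      simp only [Set.mem_Icc]
      omega
    simp only [mul_add]
    rw [finsum_add_distrib f1 f2, e1, e2, e3, e4, ← finsum_add_distrib (fin _ _) (fin _ _),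
      ← finsum_add_distrib (fin _ _) (fin _ _)]
    refine finsum_congr fun b => ?_
    rw [← add_mul, ← add_mul]
    congr 1
    have p1 := chooseZ_pascal (-s + b - 1) (r - s - 2 - b)
    have p2 := chooseZ_pascal (-s + b - 1) (r - s - 3 - b)
    simp only [ademCoeff]
    ring_nf at p1 p2 ⊢
    linear_combination p1 - p2

/-- Functions on triples that are compatible with the Adem relations applied to the first two
or to the last two entries. -/
structure TripleDual (φ : ℤ → ℤ → ℤ → ZMod 2) : Prop where
  left : ∀ p, AdemDual fun r s => φ r s p
  right : ∀ r, AdemDual fun s p => φ r s p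

lemma TripleDual.shift {φ : ℤ → ℤ → ℤ → ZMod 2} (h : TripleDual φ) :
    TripleDual fun r s p => φ (r - 4) (s - 2) (p - 1) where
  left p := by simpa [sub_sub] using ((h.left (p - 1)).shift).shift
  right r := (h.right (r - 4)).shift

lemma TripleDual.skew {φ : ℤ → ℤ → ℤ → ZMod 2} (h : TripleDual φ) :
    TripleDual fun r s p =>
      φ (r - 3) (s - 2) (p - 1) + (φ (r - 4) (s - 1) (p - 1) + φ (r - 4) (s - 2) p) where
  left p := by
    convert ((h.left (p - 1)).skew.shift).add (h.left p).shift.shift using 3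
    ring_nf
  right r := (h.right (r - 3)).shift.add (by convert (h.right (r - 4)).skew using 3; ring)

lemma TripleDual.double {φ : ℤ → ℤ → ℤ → ZMod 2} (h : TripleDual φ) :
    TripleDual fun r s p =>
      φ (r - 4) s p + (φ (r - 2) (s - 1) (p - 1) + φ (r - 2) (s - 2) p) where
  left p := by
    convert ((h.left p).skew.skew).add (h.left (p - 1)).shift using 3 with r s
    have two : (2 : ZMod 2) = 0 := rfl
    ring_nf
    linear_combination (-φ (-3 + r) (-1 + s) p) * two
  right r := (h.right (r - 4)).add (by convert (h.right (r - 2)).skew using 3; ring)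

/-- Lexicographic order on triples. -/
def lexLE (a b c r s p : ℤ) : Prop := a < r ∨ a = r ∧ (b < s ∨ b = s ∧ c ≤ p)

instance (a b c r s p : ℤ) : Decidable (lexLE a b c r s p) := by
  unfold lexLE
  infer_instance

/-- The triple `(r, s, p)` is the leading term of a functional on triples that is compatible with
all Adem relations. -/
def IsLeading (r s p : ℤ) : Prop :=
  ∃ φ, TripleDual φ ∧ φ r s p = 1 ∧ ∀ a b c, φ a b c ≠ 0 → lexLE a b c r s p

lemma lexLE_of_add_ne_zero {x y : ZMod 2} {P : Prop} (hx : x ≠ 0 → P) (hy : y ≠ 0 → P)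
    (h : x + y ≠ 0) : P := by
  by_cases h0 : x = 0
  · exact hy (by simpa [h0] using h)
  · exact hx h0

lemma IsLeading.shift {r s p : ℤ} (h : IsLeading r s p) : IsLeading (r + 4) (s + 2) (p + 1) := by
  obtain ⟨φ, h1, h2, h3⟩ := h
  refine ⟨_, h1.shift, by simpa using h2, fun a b c h => ?_⟩
  have := h3 _ _ _ h
  unfold lexLE at *
  omega

lemma IsLeading.skew {r s p : ℤ} (h : IsLeading r s p) : IsLeading (r + 4) (s + 2) p := by
  obtain ⟨φ, h1, h2, h3⟩ := h
  refine ⟨_, h1.skew, ?_, fun a b c => ?_⟩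
  · have e1 : φ (r + 4 - 3) (s + 2 - 2) (p - 1) = 0 := by
      by_contra h
      have := h3 _ _ _ h
      unfold lexLE at this
      omega
    have e2 : φ (r + 4 - 4) (s + 2 - 1) (p - 1) = 0 := by
      by_contra h
      have := h3 _ _ _ h
      unfold lexLE at this
      omega
    rw [e1, e2]
    simpa using h2
  · have := h3 (a - 3) (b - 2) (c - 1)
    have := h3 (a - 4) (b - 1) (c - 1)
    have := h3 (a - 4) (b - 2) c
    unfold lexLE at *
    refine lexLE_of_add_ne_zero ?_ (lexLE_of_add_ne_zero ?_ ?_) <;> intro h <;> grind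

lemma IsLeading.double {r s p : ℤ} (h : IsLeading r s p) : IsLeading (r + 4) s p := by
  obtain ⟨φ, h1, h2, h3⟩ := h
  refine ⟨_, h1.double, ?_, fun a b c => ?_⟩
  · have e1 : φ (r + 4 - 2) (s - 1) (p - 1) = 0 := by
      by_contra h
      have := h3 _ _ _ h
      unfold lexLE at this
      omega
    have e2 : φ (r + 4 - 2) (s - 2) p = 0 := by
      by_contra h
      have := h3 _ _ _ h
      unfold lexLE at this
      omega
    rw [e1, e2]
    simpa using h2
  · have := h3 (a - 4) b c
    have := h3 (a - 2) (b - 1) (c - 1)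
    have := h3 (a - 2) (b - 2) c
    unfold lexLE at *
    refine lexLE_of_add_ne_zero ?_ (lexLE_of_add_ne_zero ?_ ?_) <;> intro h <;> grind

/-- A finitely checkable condition on a finite set of pairs whose indicator function is
compatible with the Adem relations. -/
def AdemCheck (T : Finset (ℤ × ℤ)) (B : ℕ) : Prop :=
  (∀ x ∈ T, 0 ≤ x.2 ∧ x.2 < x.1 ∧ x.1 + x.2 ≤ B) ∧
    ∀ r ∈ Finset.range (B + 1), ∀ s ∈ Finset.range r,
      (if ((r : ℤ), (s : ℤ)) ∈ T then (1 : ZMod 2) else 0) =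
        ∑ x ∈ T.filter fun x => x.1 + x.2 = (r : ℤ) + s, ademCoeff r s x.1

instance (T : Finset (ℤ × ℤ)) (B : ℕ) : Decidable (AdemCheck T B) := by
  unfold AdemCheck
  infer_instance

lemma AdemCheck.ademDual {T : Finset (ℤ × ℤ)} {B : ℕ} (h : AdemCheck T B) :
    AdemDual fun r s => if (r, s) ∈ T then 1 else 0 where
  supp a b hab := by
    have := h.1 (a, b) (by by_contra h'; simp [h'] at hab)
    omega
  eq r s := by
    have key : ∑ᶠ b, ademCoeff r s (r + s - b) * (if (r + s - b, b) ∈ T then 1 else 0) =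
        ∑ x ∈ T with x.1 + x.2 = r + s, ademCoeff r s x.1 := by
      rw [finsum_eq_sum_of_support_subset
        (s := (T.filter fun x => x.1 + x.2 = r + s).image Prod.snd), Finset.sum_image]
      · refine Finset.sum_congr rfl fun x hx => ?_
        rw [Finset.mem_filter] at hx
        have : r + s - x.2 = x.1 := by omega
        rw [this, if_pos hx.1, mul_one]
      · intro x hx y hy hxy
        simp only [Finset.coe_filter, Set.mem_ofPred_eq] at hx hy
        exact Prod.ext (by omega) hxy
      · intro b hb
        have hb' : (r + s - b, b) ∈ T := by
          by_contra h'
          simp [h'] at hb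
        simp only [Finset.coe_image, Set.mem_image, Finset.coe_filter, Set.mem_ofPred_eq]
        exact ⟨_, ⟨hb', by simp⟩, rfl⟩
    rw [key]
    by_cases hrs : 0 ≤ s ∧ s < r
    · by_cases hB : r ≤ B
      · have := h.2 r.toNat (by simp; omega) s.toNat (by simp; omega)
        rwa [Int.toNat_of_nonneg hrs.1, Int.toNat_of_nonneg (by omega)] at this
      · rw [if_neg fun h' => ?_, Finset.filter_false_of_mem fun x hx => ?_, Finset.sum_empty]
        · have := h.1 _ hx
          omega
        · have := h.1 _ h'
          omega
    · rw [if_neg fun h' => ?_, Finset.sum_eq_zero fun x hx => ?_]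
      · rw [Finset.mem_filter] at hx
        have := h.1 _ hx.1
        exact ademCoeff_eq_zero (by omega) (by omega) hrs
      · have := h.1 _ h'
        omega

/-- A finitely checkable condition on a finite set of triples whose indicator function is
compatible with the Adem relations. -/
def TripleCheck (T : Finset (ℤ × ℤ × ℤ)) (B : ℕ) : Prop :=
  (∀ x ∈ T, 0 ≤ x.2.2 ∧ x.2.2 ≤ B ∧ 0 ≤ x.1 ∧ x.1 ≤ B) ∧
    (∀ p ∈ Finset.range (B + 1),
      AdemCheck ((T.filter fun x => x.2.2 = (p : ℤ)).image fun x => (x.1, x.2.1)) B) ∧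
    ∀ r ∈ Finset.range (B + 1), AdemCheck ((T.filter fun x => x.1 = (r : ℤ)).image Prod.snd) B

instance (T : Finset (ℤ × ℤ × ℤ)) (B : ℕ) : Decidable (TripleCheck T B) := by
  unfold TripleCheck
  infer_instance

lemma TripleCheck.tripleDual {T : Finset (ℤ × ℤ × ℤ)} {B : ℕ} (h : TripleCheck T B) :
    TripleDual fun r s p => if (r, s, p) ∈ T then 1 else 0 where
  left p := by
    by_cases hp : 0 ≤ p ∧ p ≤ B
    · obtain ⟨k, rfl⟩ : ∃ k : ℕ, p = k := ⟨p.toNat, by omega⟩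
      convert (h.2.1 k (by simp; omega)).ademDual using 4 with r s
      simp
    · convert AdemDual.zero using 3 with r s
      exact if_neg fun h' => hp ⟨(h.1 _ h').1, (h.1 _ h').2.1⟩
  right r := by
    by_cases hr : 0 ≤ r ∧ r ≤ B
    · obtain ⟨k, rfl⟩ : ∃ k : ℕ, r = k := ⟨r.toNat, by omega⟩
      convert (h.2.2 k (by simp; omega)).ademDual using 4 with s p
      simp
    · convert AdemDual.zero using 3 with s p
      exact if_neg fun h' => hr (h.1 _ h').2.2

lemma TripleCheck.isLeading {T : Finset (ℤ × ℤ × ℤ)} {B : ℕ} (h : TripleCheck T B) {r s p : ℤ}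
    (h1 : (r, s, p) ∈ T) (h2 : ∀ x ∈ T, lexLE x.1 x.2.1 x.2.2 r s p) : IsLeading r s p :=
  ⟨_, h.tripleDual, if_pos h1, fun a b c h' =>
    h2 (a, b, c) (by by_contra h0; exact h' (if_neg h0))⟩

lemma isLeading_base {a b : ℕ} (ha : a < 4) (hb : b < 2) :
    IsLeading (2 * (1 + b) + 1 + a) (1 + b) 0 := by
  interval_cases b <;> interval_cases a
  · exact TripleCheck.isLeading (T := {(3, 1, 0)}) (B := 9) (by decide +kernel) (by decide)
      (by decide)
  · exact TripleCheck.isLeading (T := {(4, 1, 0)}) (B := 9) (by decide +kernel) (by decide)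
      (by decide)
  · exact TripleCheck.isLeading (T := {(5, 1, 0), (4, 2, 0)}) (B := 9) (by decide +kernel)
      (by decide) (by decide)
  · exact TripleCheck.isLeading (T := {(6, 1, 0)}) (B := 9) (by decide +kernel) (by decide)
      (by decide)
  · exact TripleCheck.isLeading (T := {(5, 2, 0)}) (B := 9) (by decide +kernel) (by decide)
      (by decide)
  · exact TripleCheck.isLeading (T := {(6, 2, 0)}) (B := 9) (by decide +kernel) (by decide)
      (by decide)
  · exact TripleCheck.isLeading (T := {(7, 2, 0), (6, 3, 0), (6, 2, 1)}) (B := 9)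
      (by decide +kernel) (by decide) (by decide)
  · exact TripleCheck.isLeading (T := {(8, 2, 0)}) (B := 10) (by decide +kernel) (by decide)
      (by decide)

lemma isLeading_of_CU (r s p : ℕ) (h1 : 2 * s + 1 ≤ r) (h2 : 2 * p + 1 ≤ s) :
    IsLeading r s p := by
  induction r using Nat.strong_induction_on generalizing s p with
  | _ r ih =>
    by_cases hp : 1 ≤ p
    · have := (ih (r - 4) (by omega) (s - 2) (p - 1) (by omega) (by omega)).shift
      convert this using 1 <;> omega
    by_cases hs : 3 ≤ s
    · have := (ih (r - 4) (by omega) (s - 2) p (by omega) (by omega)).skew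
      convert this using 1; omega; omega
    by_cases hr : 2 * s + 5 ≤ r
    · have := (ih (r - 4) (by omega) s p (by omega) (by omega)).double
      convert this using 1; omega
    · have := isLeading_base (a := r - 2 * s - 1) (b := s - 1) (by omega) (by omega)
      convert this using 1 <;> omega

/-- The right-hand side of the Adem relation for `q_r q_s`, with `q_a q_b` replaced by `f a b`. -/
def ademSum {M : Type*} [AddCommMonoid M] [Module (ZMod 2) M] (r s : ℕ) (f : ℕ → ℕ → M) : M :=
  ∑ ℓ ∈ Finset.range (r - s),
    ((2 * s - r + 1 + 2 * ℓ).choose ℓ : ZMod 2) • f (2 * s + 1 + ℓ) (r - s - 1 - ℓ)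

lemma ademSum_eq_zero_of_le {M : Type*} [AddCommMonoid M] [Module (ZMod 2) M] {r s : ℕ}
    (h : r ≤ s) (f : ℕ → ℕ → M) : ademSum r s f = 0 := by
  simp [ademSum, Nat.sub_eq_zero_of_le h]

lemma map_ademSum {M N : Type*} [AddCommMonoid M] [Module (ZMod 2) M] [AddCommMonoid N]
    [Module (ZMod 2) N] (g : M →ₗ[ZMod 2] N) (r s : ℕ) (f : ℕ → ℕ → M) :
    g (ademSum r s f) = ademSum r s fun a b => g (f a b) := by
  simp [ademSum]

lemma ademSum_mem {M : Type*} [AddCommMonoid M] [Module (ZMod 2) M] {r s : ℕ}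
    {f : ℕ → ℕ → M} {P : Submodule (ZMod 2) M}
    (h : ∀ a b, a + b = r + s → 2 * s + 1 ≤ a → s + b < r → f a b ∈ P) : ademSum r s f ∈ P := by
  refine Submodule.sum_mem _ fun ℓ hℓ => Submodule.smul_mem _ _ ?_
  rw [Finset.mem_range] at hℓ
  exact h _ _ (by omega) (by omega) (by omega)

lemma ademSum_congr {M : Type*} [AddCommMonoid M] [Module (ZMod 2) M] {r s : ℕ}
    {f g : ℕ → ℕ → M}
    (h : ∀ a b, a + b = r + s → 2 * s + 1 ≤ a → s + b < r → f a b = g a b) :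
    ademSum r s f = ademSum r s g := by
  refine Finset.sum_congr rfl fun ℓ hℓ => ?_
  rw [Finset.mem_range] at hℓ
  rw [h _ _ (by omega) (by omega) (by omega)]

lemma AdemDual.eq_ademSum {ψ : ℤ → ℤ → ZMod 2} (h : AdemDual ψ) {r s : ℕ} (hrs : r ≤ 2 * s) :
    ψ r s = ademSum r s fun a b => ψ a b := by
  rw [h.eq, finsum_eq_sum_of_support_subset
    (s := (Finset.range (r - s)).image fun ℓ => ((r - s - 1 - ℓ : ℕ) : ℤ)), Finset.sum_image]
  · refine Finset.sum_congr rfl fun ℓ hℓ => ?_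
    rw [Finset.mem_range] at hℓ
    have : (r : ℤ) + s - (r - s - 1 - ℓ : ℕ) = (2 * s + 1 + ℓ : ℕ) := by omega
    rw [this, ademCoeff_natCast hrs, smul_eq_mul]
  · intro x hx y hy hxy
    simp only [Finset.coe_range, Set.mem_Iio] at hx hy
    simp only [Nat.cast_inj] at hxy
    omega
  · intro b hb
    have h1 := h.supp _ _ (right_ne_zero_of_mul hb)
    have h2 : ¬ ((r : ℤ) + s - b - 2 * s - 1 < 0) := fun h' =>
      left_ne_zero_of_mul hb (chooseZ_of_neg h')
    simp only [Finset.coe_image, Set.mem_image, Finset.coe_range, Set.mem_Iio]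
    exact ⟨r - s - 1 - b.toNat, by omega, by omega⟩

/-- The free module on words of length three. -/
abbrev Triples := ℕ × ℕ × ℕ →₀ ZMod 2

/-- The word `q_r q_s q_p`. -/
noncomputable def triple (r s p : ℕ) : Triples := Finsupp.single (r, s, p) 1

/-- The Adem relation for `q_r q_s`, multiplied by `q_p` on the right. -/
noncomputable def relLeft (r s p : ℕ) : Triples :=
  triple r s p - ademSum r s fun a b => triple a b p

/-- The Adem relation for `q_s q_p`, multiplied by `q_r` on the left. -/
noncomputable def relRight (r s p : ℕ) : Triples :=
  triple r s p - ademSum s p fun a b => triple r a b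

/-- The span of all Adem relations among words of length three. -/
noncomputable def relSpan : Submodule (ZMod 2) Triples :=
  Submodule.span (ZMod 2) {x | ∃ r s p, (r ≤ 2 * s ∧ x = relLeft r s p) ∨
    (s ≤ 2 * p ∧ x = relRight r s p)}

/-- The span of the completely unadmissible words of length three. -/
noncomputable def cuSpan : Submodule (ZMod 2) Triples :=
  Finsupp.supported (ZMod 2) (ZMod 2) {w | 2 * w.2.1 + 1 ≤ w.1 ∧ 2 * w.2.2 + 1 ≤ w.2.1}

lemma relLeft_mem {r s : ℕ} (h : r ≤ 2 * s) (p : ℕ) : relLeft r s p ∈ relSpan :=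
  Submodule.subset_span ⟨r, s, p, Or.inl ⟨h, rfl⟩⟩

lemma relRight_mem (r : ℕ) {s p : ℕ} (h : s ≤ 2 * p) : relRight r s p ∈ relSpan :=
  Submodule.subset_span ⟨r, s, p, Or.inr ⟨h, rfl⟩⟩

lemma triple_mem_cuSpan {r s p : ℕ} (h1 : 2 * s + 1 ≤ r) (h2 : 2 * p + 1 ≤ s) :
    triple r s p ∈ cuSpan :=
  Finsupp.single_mem_supported _ _ ⟨h1, h2⟩

/-- Evaluation of words of length three. -/
noncomputable def evalTriple {M : Type*} [AddCommMonoid M] [Module (ZMod 2) M]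
    (e : ℕ → ℕ → ℕ → M) : Triples →ₗ[ZMod 2] M :=
  Finsupp.linearCombination (ZMod 2) fun w => e w.1 w.2.1 w.2.2

@[simp]
lemma evalTriple_triple {M : Type*} [AddCommMonoid M] [Module (ZMod 2) M]
    (e : ℕ → ℕ → ℕ → M) (r s p : ℕ) : evalTriple e (triple r s p) = e r s p := by
  simp [evalTriple, triple]

lemma TripleDual.evalTriple_eq_zero {φ : ℤ → ℤ → ℤ → ZMod 2} (h : TripleDual φ) {x : Triples}
    (hx : x ∈ relSpan) : evalTriple (fun r s p => φ r s p) x = 0 := by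
  suffices relSpan ≤ LinearMap.ker (evalTriple fun r s p : ℕ => φ r s p) from this hx
  rw [relSpan, Submodule.span_le]
  rintro _ ⟨r, s, p, ⟨hrs, rfl⟩ | ⟨hsp, rfl⟩⟩
  · simp [relLeft, map_ademSum, (h.left p).eq_ademSum hrs]
  · simp [relRight, map_ademSum, (h.right r).eq_ademSum hsp]

lemma disjoint_relSpan_cuSpan : Disjoint relSpan cuSpan := by
  rw [Submodule.disjoint_def]
  intro x hrel hcu
  by_contra hx
  obtain ⟨J, hJ, hmin⟩ := x.support.exists_min_image
    (fun w => toLex (w.1, toLex (w.2.1, w.2.2))) (Finsupp.support_nonempty_iff.2 hx)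
  have hcu' := (Finsupp.mem_supported _ _).1 hcu hJ
  obtain ⟨φ, h1, h2, h3⟩ := isLeading_of_CU J.1 J.2.1 J.2.2 hcu'.1 hcu'.2
  have := h1.evalTriple_eq_zero hrel
  rw [evalTriple, Finsupp.linearCombination_apply, Finsupp.sum, Finset.sum_eq_single J] at this
  · rw [h2] at this
    simp at this
    simp [this] at hJ
  · intro w hw hne
    have hw' := hmin w hw
    rw [smul_eq_mul, mul_eq_zero]
    right
    by_contra h0
    have := h3 _ _ _ h0
    apply hne
    simp only [Prod.Lex.toLex_le_toLex] at hw'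
    unfold lexLE at this
    refine Prod.ext ?_ (Prod.ext ?_ ?_) <;> omega
  · exact fun h => absurd hJ h

/-- The overlap (or diamond) lemma: an Adem relation on the first two letters of a word of length
three follows from relations on the last two letters together with relations on the first two
letters of words with a smaller last letter. -/
theorem adem_overlap {M : Type*} [AddCommGroup M] [Module (ZMod 2) M] (e : ℕ → ℕ → ℕ → M) {p : ℕ}
    (hright : ∀ r s c, s ≤ 2 * c → e r s c = ademSum s c fun a b => e r a b)
    (hleft : ∀ r s c, c < p → r ≤ 2 * s → e r s c = ademSum r s fun a b => e a b c)
    {r s : ℕ} (hrs : r ≤ 2 * s) (hsp : s ≤ 2 * p) :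
    e r s p = ademSum r s fun a b => e a b p := by
  set Z := relSpan ⊓ LinearMap.ker (evalTriple e) with hZ
  have zl : ∀ r s c, c < p → r ≤ 2 * s → relLeft r s c ∈ Z := fun r s c hc h =>
    ⟨relLeft_mem h c, by simp [relLeft, map_ademSum, hleft r s c hc h]⟩
  have zr : ∀ r s c, s ≤ 2 * c → relRight r s c ∈ Z := fun r s c h =>
    ⟨relRight_mem r h, by simp [relRight, map_ademSum, hright r s c h]⟩
  have good : ∀ c < p, ∀ k r s, s ≤ k → triple r s c ∈ cuSpan ⊔ Z := by
    intro c
    induction c using Nat.strong_induction_on with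
    | _ c ih =>
      intro hc k
      induction k with
      | zero =>
        intro r s hs
        have := Submodule.mem_sup_right (S := cuSpan) (zr r s c (by omega))
        rw [relRight, ademSum_eq_zero_of_le (by omega), sub_zero] at this
        exact this
      | succ k ihk =>
        intro r s hs
        by_cases h1 : s ≤ 2 * c
        · have := Submodule.mem_sup_right (S := cuSpan) (zr r s c h1)
          rw [relRight] at this
          refine (Submodule.sub_mem_iff_left _ (ademSum_mem fun a b _ _ h => ?_)).1 this
          exact ih b (by omega) (by omega) _ r a le_rfl
        · by_cases h2 : r ≤ 2 * s
          · have := Submodule.mem_sup_right (S := cuSpan) (zl r s c hc h2)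
            rw [relLeft] at this
            refine (Submodule.sub_mem_iff_left _ (ademSum_mem fun a b _ _ h => ?_)).1 this
            exact ihk a b (by omega)
          · exact Submodule.mem_sup_left (triple_mem_cuSpan (by omega) (by omega))
  have good' : ∀ r s, s ≤ 2 * p → triple r s p ∈ cuSpan ⊔ Z := by
    intro r s h
    have := Submodule.mem_sup_right (S := cuSpan) (zr r s p h)
    rw [relRight] at this
    refine (Submodule.sub_mem_iff_left _ (ademSum_mem fun a b _ _ h => ?_)).1 this
    exact good b (by omega) _ r a le_rfl
  have hmem : relLeft r s p ∈ cuSpan ⊔ Z :=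
    Submodule.sub_mem _ (good' r s hsp) (ademSum_mem fun a b _ _ h => good' a b (by omega))
  obtain ⟨y, hy, z, hz, hyz⟩ := Submodule.mem_sup.1 hmem
  have hy0 : y = 0 := Submodule.disjoint_def.1 disjoint_relSpan_cuSpan y
    (by rw [eq_sub_of_add_eq hyz]; exact Submodule.sub_mem _ (relLeft_mem hrs p) hz.1) hy
  rw [hy0, zero_add] at hyz
  have := hz.2
  rw [hyz] at this
  simpa [relLeft, map_ademSum, sub_eq_zero] using this

/-- Completely unadmissible sequences of excess at least `n`. -/
def IsCU (n : ℕ) (J : List ℕ) : Prop :=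
  List.IsChain (fun a b => 2 * b + 1 ≤ a) J ∧ ∀ m ∈ J.getLast?, n ≤ m

/-- The type of completely unadmissible sequences of excess at least `n`. -/
abbrev CUWord (n : ℕ) : Type := {J : List ℕ // IsCU n J}

lemma isCU_nil (n : ℕ) : IsCU n [] := by
  simp [IsCU]

lemma isCU_singleton {n j : ℕ} : IsCU n [j] ↔ n ≤ j := by
  simp [IsCU]

lemma isCU_cons_cons {n j c : ℕ} {J : List ℕ} :
    IsCU n (j :: c :: J) ↔ 2 * c + 1 ≤ j ∧ IsCU n (c :: J) := by
  simp [IsCU, List.getLast?_cons_cons, and_assoc]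

lemma IsCU.tail {n c : ℕ} {J : List ℕ} (h : IsCU n (c :: J)) : IsCU n J := by
  cases J with
  | nil => exact isCU_nil n
  | cons d J => exact (isCU_cons_cons.1 h).2

lemma IsCU.sum_add_le {n c : ℕ} {J : List ℕ} (h : IsCU n (c :: J)) : J.sum + n ≤ c := by
  induction J generalizing c with
  | nil => simpa using isCU_singleton.1 h
  | cons d J ih =>
    have h1 := isCU_cons_cons.1 h
    have := ih h1.2
    simp only [List.sum_cons]
    omega

/-- The action of the generator `q_j` on completely unadmissible words, computed by
repeatedly rewriting with the defining relations. -/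
noncomputable def cuMul (n j : ℕ) : CUWord n → (CUWord n →₀ ZMod 2)
  | ⟨[], _⟩ => if h : n ≤ j then Finsupp.single ⟨[j], isCU_singleton.2 h⟩ 1 else 0
  | ⟨c :: J, hJ⟩ =>
    if h : 2 * c + 1 ≤ j then Finsupp.single ⟨j :: c :: J, isCU_cons_cons.2 ⟨h, hJ⟩⟩ 1
    else if _hc : 0 < c then
      ademSum j c fun a b => (cuMul n b ⟨J, IsCU.tail hJ⟩).sum fun L x =>
        x • if _hL : L.1.sum < (c :: J).sum then cuMul n a L else 0
    else 0
termination_by L => L.1.sum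
decreasing_by
  · simp [_hc]
  · exact _hL

/-- The linear extension of `cuMul`. -/
noncomputable def cuOp (n j : ℕ) : (CUWord n →₀ ZMod 2) →ₗ[ZMod 2] CUWord n →₀ ZMod 2 :=
  Finsupp.linearCombination (ZMod 2) (cuMul n j)

/-- The span of the completely unadmissible words of degree `d`. -/
noncomputable def cuDeg (n d : ℕ) : Submodule (ZMod 2) (CUWord n →₀ ZMod 2) :=
  Finsupp.supported (ZMod 2) (ZMod 2) {L | L.1.sum = d}

@[simp]
lemma cuOp_single (n j : ℕ) (L : CUWord n) : cuOp n j (Finsupp.single L 1) = cuMul n j L := by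
  simp [cuOp]

lemma eqOn_cuDeg {M : Type*} [AddCommMonoid M] [Module (ZMod 2) M] {n d : ℕ}
    {f g : (CUWord n →₀ ZMod 2) →ₗ[ZMod 2] M}
    (h : ∀ L : CUWord n, L.1.sum = d → f (Finsupp.single L 1) = g (Finsupp.single L 1))
    {x : CUWord n →₀ ZMod 2} (hx : x ∈ cuDeg n d) : f x = g x := by
  rw [cuDeg, Finsupp.supported_eq_span_single] at hx
  refine LinearMap.eqOn_span (s := _) ?_ hx
  rintro _ ⟨L, hL, rfl⟩
  exact h L hL

lemma cuMul_mem (n j : ℕ) (L : CUWord n) : cuMul n j L ∈ cuDeg n (j + L.1.sum) := by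
  induction hm : L.1.sum using Nat.strong_induction_on generalizing j L with
  | _ m ih =>
    obtain ⟨_ | ⟨c, J⟩, hJ⟩ := L
    · rw [cuMul]
      split_ifs
      · exact Finsupp.single_mem_supported _ _ (by simp [← hm])
      · exact zero_mem _
    · rw [cuMul]
      simp only [List.sum_cons] at hm
      split_ifs with h hc
      · exact Finsupp.single_mem_supported _ _ (by simp [← hm])
      · refine ademSum_mem fun a b hab _ _ => Submodule.sum_mem _ fun L hL =>
          Submodule.smul_mem _ _ ?_
        have hL' := (Finsupp.mem_supported _ _).1 (ih J.sum (by omega) b ⟨J, hJ.tail⟩ rfl) hL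
        simp only [Set.mem_ofPred_eq] at hL'
        split_ifs with hlt
        · have := ih L.1.sum (by simpa [← hm] using hlt) a L rfl
          rwa [hL', ← add_assoc, hab, add_assoc, hm] at this
        · exact zero_mem _
      · exact zero_mem _

lemma cuOp_mem {n d : ℕ} (j : ℕ) {x : CUWord n →₀ ZMod 2} (hx : x ∈ cuDeg n d) :
    cuOp n j x ∈ cuDeg n (j + d) := by
  refine Submodule.sum_mem _ fun L hL => Submodule.smul_mem _ _ ?_
  have := (Finsupp.mem_supported _ _).1 hx hL
  simp only [Set.mem_ofPred_eq] at this
  rw [← this]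
  exact cuMul_mem n j L

lemma cuMul_nil_of_lt {n j : ℕ} (h : j < n) (h0 : IsCU n []) : cuMul n j ⟨[], h0⟩ = 0 := by
  rw [cuMul, dif_neg (by omega)]

lemma cuMul_of_isCU {n j : ℕ} {J : List ℕ} (h : IsCU n (j :: J)) (hJ : IsCU n J) :
    cuMul n j ⟨J, hJ⟩ = Finsupp.single ⟨j :: J, h⟩ 1 := by
  cases J with
  | nil => rw [cuMul, dif_pos (isCU_singleton.1 h)]
  | cons c J => rw [cuMul, dif_pos (isCU_cons_cons.1 h).1]

lemma cuMul_cons_of_le {n j c : ℕ} {J : List ℕ} (h : j ≤ 2 * c) (hJ : IsCU n (c :: J)) :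
    cuMul n j ⟨c :: J, hJ⟩ = ademSum j c fun a b => cuOp n a (cuMul n b ⟨J, hJ.tail⟩) := by
  rw [cuMul, dif_neg (by omega)]
  split_ifs with hc
  · refine ademSum_congr fun a b hab _ _ => ?_
    rw [cuOp, Finsupp.linearCombination_apply]
    refine Finset.sum_congr rfl fun L hL => ?_
    have := (Finsupp.mem_supported _ _).1 (cuMul_mem n b ⟨J, hJ.tail⟩) hL
    simp only [Set.mem_ofPred_eq] at this
    dsimp only
    rw [dif_pos (by rw [this, List.sum_cons]; omega)]
  · exact (ademSum_eq_zero_of_le (by omega) _).symm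

lemma cuMul_eq_zero {n j : ℕ} {L : CUWord n} (h : j < L.1.sum + n) : cuMul n j L = 0 := by
  obtain ⟨J, hJ⟩ := L
  induction J generalizing j with
  | nil => exact cuMul_nil_of_lt (by simpa using h) hJ
  | cons c J ih =>
    have h1 := hJ.sum_add_le
    simp only [List.sum_cons] at h
    rw [cuMul_cons_of_le (by omega)]
    rw [← Submodule.mem_bot (ZMod 2)]
    refine ademSum_mem fun a b _ _ hb => ?_
    rw [ih _ (show b < J.sum + n by omega), map_zero]
    exact zero_mem _

lemma cuOp_eq_zero {n j d : ℕ} (h : j < d + n) {x : CUWord n →₀ ZMod 2} (hx : x ∈ cuDeg n d) :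
    cuOp n j x = 0 := by
  refine eqOn_cuDeg (g := 0) (fun L hL => ?_) hx
  rw [cuOp_single, LinearMap.zero_apply]
  exact cuMul_eq_zero (by omega)

lemma cuOp_adem (n : ℕ) {r s : ℕ} (h : r ≤ 2 * s) (L : CUWord n) :
    cuOp n r (cuMul n s L) = ademSum r s fun a b => cuOp n a (cuMul n b L) := by
  induction hm : L.1.sum using Nat.strong_induction_on generalizing r s L with
  | _ m ih =>
    obtain ⟨_ | ⟨p, J⟩, hJ⟩ := L
    · by_cases hs : n ≤ s
      · rw [cuMul_of_isCU (isCU_singleton.2 hs), cuOp_single, cuMul_cons_of_le h]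
      · rw [cuMul_nil_of_lt (by omega), map_zero, eq_comm, ← Submodule.mem_bot (ZMod 2)]
        refine ademSum_mem fun a b _ _ hb => ?_
        rw [cuMul_nil_of_lt (by omega), map_zero]
        exact zero_mem _
    · simp only [List.sum_cons] at hm
      by_cases hs : 2 * p + 1 ≤ s
      · rw [cuMul_of_isCU (isCU_cons_cons.2 ⟨hs, hJ⟩), cuOp_single, cuMul_cons_of_le h]
      obtain rfl | hp := Nat.eq_zero_or_pos p
      · rw [ademSum_eq_zero_of_le (by omega), cuMul_cons_of_le (by omega),
          ademSum_eq_zero_of_le (by omega), map_zero]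
      have hpJ : ∀ b, cuMul n b ⟨p :: J, hJ⟩ = cuOp n b (cuMul n p ⟨J, hJ.tail⟩) := fun b => by
        rw [cuMul_of_isCU hJ, cuOp_single]
      simp only [hpJ]
      refine adem_overlap (fun r s c => cuOp n r (cuOp n s (cuMul n c ⟨J, hJ.tail⟩)))
        (fun r s c hsc => ?_) (fun r s c hc hrs => ?_) h (by omega)
      · rw [ih J.sum (by omega) hsc _ rfl, map_ademSum]
      · have key := cuMul_mem n c ⟨J, hJ.tail⟩
        have := eqOn_cuDeg (f := cuOp n r ∘ₗ cuOp n s)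
          (g := ademSum r s fun a b => cuOp n a ∘ₗ cuOp n b) (fun L hL => ?_) key
        · simpa [ademSum] using this
        · have := ih L.1.sum (by simp only at hL; omega) hrs L rfl
          simpa [ademSum] using this

/-- The action of the free algebra on completely unadmissible words. -/
noncomputable def cuAct (n : ℕ) :
    FreeAlgebra (ZMod 2) ℕ →ₐ[ZMod 2] Module.End (ZMod 2) (CUWord n →₀ ZMod 2) :=
  FreeAlgebra.lift (ZMod 2) (cuOp n)

lemma cuAct_word_cons (n j : ℕ) (J : List ℕ) :
    cuAct n (word (j :: J)) = cuOp n j * cuAct n (word J) := by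
  simp [cuAct, word]

lemma cuAct_word_nil (n : ℕ) : cuAct n (word []) = 1 := by
  simp [word]

lemma cuAct_word_mem {n d : ℕ} (J : List ℕ) {x : CUWord n →₀ ZMod 2} (hx : x ∈ cuDeg n d) :
    cuAct n (word J) x ∈ cuDeg n (J.sum + d) := by
  induction J with
  | nil => simpa [cuAct_word_nil] using hx
  | cons j J ih =>
    rw [cuAct_word_cons, List.sum_cons, add_assoc]
    exact cuOp_mem j ih

lemma cuAct_word {n : ℕ} {J : List ℕ} (h : IsCU n J) :
    cuAct n (word J) (Finsupp.single ⟨[], isCU_nil n⟩ 1) = Finsupp.single ⟨J, h⟩ 1 := by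
  induction J with
  | nil => simp [cuAct_word_nil]
  | cons j J ih =>
    rw [cuAct_word_cons, Module.End.mul_apply, ih h.tail, cuOp_single, cuMul_of_isCU h]

lemma cuAct_rel {n : ℕ} {x y : FreeAlgebra (ZMod 2) ℕ} (h : BarRel n x y) :
    cuAct n x = cuAct n y := by
  cases h with
  | excess j J h =>
    refine Finsupp.lhom_ext' fun L => LinearMap.ext_ring ?_
    rw [cuAct_word_cons, map_zero]
    exact cuOp_eq_zero (d := J.sum + L.1.sum) (by omega)
      (cuAct_word_mem J (Finsupp.single_mem_supported _ _ rfl))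
  | adem r s h1 h2 =>
    refine Finsupp.lhom_ext' fun L => LinearMap.ext_ring ?_
    have := cuOp_adem n h2 L
    simpa [cuAct, ademSum] using this

/-- The action of `R̄_n` on completely unadmissible words. -/
noncomputable def barAct (n : ℕ) :
    BarR n →ₐ[ZMod 2] Module.End (ZMod 2) (CUWord n →₀ ZMod 2) :=
  RingQuot.liftAlgHom (ZMod 2) ⟨cuAct n, fun _ _ h => cuAct_rel h⟩

lemma barAct_barMk (n : ℕ) (x : FreeAlgebra (ZMod 2) ℕ) : barAct n (barMk n x) = cuAct n x :=
  RingQuot.liftAlgHom_mkAlgHom_apply _ _ _ _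

theorem linearIndependent_CU (n : ℕ) :
    LinearIndependent (ZMod 2) fun J : CUWord n => barMk n (word J.1) := by
  let θ : BarR n →ₗ[ZMod 2] CUWord n →₀ ZMod 2 :=
    (LinearMap.applyₗ (Finsupp.single ⟨[], isCU_nil n⟩ 1)) ∘ₗ (barAct n).toLinearMap
  refine LinearIndependent.of_comp θ ?_
  convert (Finsupp.basisSingleOne (R := ZMod 2) (ι := CUWord n)).linearIndependent using 1
  ext1 J
  simp [θ, barAct_barMk, cuAct_word J.2]

/-- The generator `q_j` of `R̄_n`. -/
noncomputable def barGen (n j : ℕ) : BarR n := barMk n (FreeAlgebra.ι (ZMod 2) j)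

lemma barMk_word_cons (n j : ℕ) (J : List ℕ) :
    barMk n (word (j :: J)) = barGen n j * barMk n (word J) := by
  simp [barGen, word]

lemma barMk_rel {n : ℕ} {x y : FreeAlgebra (ZMod 2) ℕ} (h : BarRel n x y) :
    barMk n x = barMk n y :=
  RingQuot.mkAlgHom_rel _ h

lemma barGen_mul_barGen (n : ℕ) {r s : ℕ} (h1 : s < r) (h2 : r ≤ 2 * s) :
    barGen n r * barGen n s = ademSum r s fun a b => barGen n a * barGen n b := by
  simpa [barGen, ademSum] using barMk_rel (BarRel.adem (n := n) r s h1 h2)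

/-- The span in `R̄_n` of the completely unadmissible words of degree `d`. -/
noncomputable def barDeg (n d : ℕ) : Submodule (ZMod 2) (BarR n) :=
  Submodule.span (ZMod 2) ((fun J : CUWord n => barMk n (word J.1)) '' {J | J.1.sum = d})

lemma barMk_word_mem {n : ℕ} {J : List ℕ} (h : IsCU n J) : barMk n (word J) ∈ barDeg n J.sum :=
  Submodule.subset_span ⟨⟨J, h⟩, rfl, rfl⟩

lemma barGen_mul_mem_of_forall {n d e j : ℕ}
    (h : ∀ J, IsCU n J → J.sum = d → barGen n j * barMk n (word J) ∈ barDeg n e) {x : BarR n}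
    (hx : x ∈ barDeg n d) : barGen n j * x ∈ barDeg n e := by
  suffices barDeg n d ≤ (barDeg n e).comap (LinearMap.mulLeft (ZMod 2) (barGen n j)) from this hx
  rw [barDeg, Submodule.span_le]
  rintro _ ⟨J, hJ, rfl⟩
  exact h J.1 J.2 hJ

lemma barGen_mul_word_mem {n : ℕ} (hn : 1 ≤ n) (j : ℕ) {J : List ℕ} (hJ : IsCU n J) :
    barGen n j * barMk n (word J) ∈ barDeg n (j + J.sum) := by
  induction hm : J.sum using Nat.strong_induction_on generalizing j J with
  | _ m ih =>
    subst hm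
    rw [← barMk_word_cons, ← List.sum_cons]
    by_cases hex : j < J.sum + n
    · rw [barMk_rel (BarRel.excess j J hex), map_zero]
      exact zero_mem _
    cases J with
    | nil => exact barMk_word_mem (isCU_singleton.2 (by simpa using hex))
    | cons c J =>
      simp only [List.sum_cons] at hex ih ⊢
      by_cases hj : 2 * c + 1 ≤ j
      · simpa only [List.sum_cons] using barMk_word_mem (isCU_cons_cons.2 ⟨hj, hJ⟩)
      rw [barMk_word_cons, barMk_word_cons, ← mul_assoc,
        barGen_mul_barGen n (by omega) (by omega)]
      have hmap : ademSum j c (fun a b => barGen n a * barGen n b) * barMk n (word J) =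
          ademSum j c fun a b => barGen n a * (barGen n b * barMk n (word J)) := by
        simp only [ademSum, Finset.sum_mul, smul_mul_assoc, mul_assoc]
      rw [hmap]
      refine ademSum_mem fun a b hab _ _ => ?_
      have key := ih J.sum (by omega) b hJ.tail rfl
      refine barGen_mul_mem_of_forall (fun L hL hsum => ?_) key
      have := ih L.sum (by omega) a hL rfl
      rwa [hsum, show a + (b + J.sum) = j + (c + J.sum) by omega] at this

theorem span_CU {n : ℕ} (hn : 1 ≤ n) :
    Submodule.span (ZMod 2) (Set.range fun J : CUWord n => barMk n (word J.1)) = ⊤ := by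
  set S := Submodule.span (ZMod 2) (Set.range fun J : CUWord n => barMk n (word J.1)) with hS
  have hdeg : ∀ d, barDeg n d ≤ S := fun d => Submodule.span_mono (Set.image_subset_range _ _)
  have hgen : ∀ j, ∀ y ∈ S, barGen n j * y ∈ S := fun j y hy => by
    suffices S ≤ S.comap (LinearMap.mulLeft (ZMod 2) (barGen n j)) from this hy
    conv_lhs => rw [hS]
    rw [Submodule.span_le]
    rintro _ ⟨J, rfl⟩
    exact hdeg _ (barGen_mul_word_mem hn j J.2)
  have hone : (1 : BarR n) ∈ S := Submodule.subset_span ⟨⟨[], isCU_nil n⟩, by simp [word]⟩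
  have hmul : ∀ x : FreeAlgebra (ZMod 2) ℕ, ∀ y ∈ S, barMk n x * y ∈ S := by
    intro x
    induction x using FreeAlgebra.induction with
    | grade0 r =>
      intro y hy
      rw [AlgHom.commutes, ← Algebra.smul_def]
      exact S.smul_mem r hy
    | grade1 j => exact hgen j
    | mul a b ha hb =>
      intro y hy
      rw [map_mul, mul_assoc]
      exact ha _ (hb y hy)
    | add a b ha hb =>
      intro y hy
      rw [map_add, add_mul]
      exact S.add_mem (ha y hy) (hb y hy)
  rw [eq_top_iff]
  rintro x -
  obtain ⟨z, rfl⟩ := RingQuot.mkAlgHom_surjective (ZMod 2) (BarRel n) x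
  exact mul_one (barMk n z) ▸ hmul z 1 hone

/-- For `n ≥ 1`, the images in `R̄_n` of the words `q_{j_1}⋯q_{j_k}`, as `(j_1, …, j_k)`
ranges over all completely unadmissible sequences with last entry at least `n` (the
empty sequence contributing the unit `1`), form a basis of `R̄_n` over `ZMod 2`:
they are linearly independent and span. -/
theorem barR_CU_basis (n : ℕ) (hn : 1 ≤ n) :
    LinearIndependent (ZMod 2) (fun J : CUSeq n => barMk n (word J.1)) ∧
      Submodule.span (ZMod 2) (Set.range fun J : CUSeq n => barMk n (word J.1)) = ⊤ := by
  exact ⟨linearIndependent_CU n, span_CU hn⟩
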